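/- Let D be a symmetric traceless 3×3 real matrix, W₀ = Σ_{m,n} D_{mn} x^m x^n on the unit sphere S², and let P be a smooth function on S² satisfying ∫_{S²} P x^m dS² = 0 for m = 1,2,3. Then for each i, ∫_{S²} W₀ (∇x^i · ∇P) dS² = 4 ∫_{S²} W₀ x^i P dS², where ∇ is the round-metric gradient. -/

import Mathlib

open MeasureTheory
open scoped RealInnerProductSpace

noncomputable section

abbrev E3 := EuclideanSpace ℝ (Fin 3)

noncomputable def sphereInt (f : E3 → ℝ) : ℝ :=
  ∫ x in Metric.sphere (0 : E3) 1, f x ∂(μH[2])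

/-- Degree-zero homogeneous extension of a function on the unit sphere. -/
noncomputable def homExt (f : E3 → ℝ) : E3 → ℝ := fun y => f (‖y‖⁻¹ • y)

/-- Round-metric gradient on the unit sphere: the Euclidean gradient of the
degree-zero homogeneous extension. -/
noncomputable def sGrad (f : E3 → ℝ) (x : E3) : E3 := gradient (homExt f) x

theorem hausdorffMeasure_sphere_lt_top : μH[2] (Metric.sphere (0 : E3) 1) < ⊤ := by
  let g : ℝ × ℝ → E3 := fun p =>
    !₂[Real.sin p.1 * Real.cos p.2, Real.sin p.1 * Real.sin p.2, Real.cos p.1]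
  have hg : ContDiff ℝ 1 g := by
    rw [contDiff_euclidean]
    intro i
    fin_cases i <;> simp [g] <;> fun_prop
  let K : Set (ℝ × ℝ) := Set.Icc 0 Real.pi ×ˢ Set.Icc (-Real.pi) Real.pi
  have hK : IsCompact K := isCompact_Icc.prod isCompact_Icc
  obtain ⟨C, hC⟩ :=
    (hg.locallyLipschitz.locallyLipschitzOn (s := K)).exists_lipschitzOnWith_of_compact hK
  have hsub : Metric.sphere (0 : E3) 1 ⊆ g '' K := by
    intro x hx
    have hx1 : x 0 ^ 2 + x 1 ^ 2 + x 2 ^ 2 = 1 := by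
      have h := EuclideanSpace.real_norm_sq_eq x
      rw [mem_sphere_zero_iff_norm.1 hx, Fin.sum_univ_three] at h
      linarith
    have h2 : -1 ≤ x 2 ∧ x 2 ≤ 1 := by
      constructor <;> nlinarith [sq_nonneg (x 0), sq_nonneg (x 1)]
    let z : ℂ := ⟨x 0, x 1⟩
    have hz : Real.sin (Real.arccos (x 2)) = ‖z‖ := by
      rw [Real.sin_arccos, Complex.norm_def, Complex.normSq_apply]
      congr 1
      simp only [z]
      linarith
    refine ⟨(Real.arccos (x 2), z.arg), ⟨⟨Real.arccos_nonneg _, Real.arccos_le_pi _⟩,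
      ⟨(Complex.neg_pi_lt_arg z).le, Complex.arg_le_pi z⟩⟩, ?_⟩
    ext i
    fin_cases i
    · simp [g, hz, z]
    · simp [g, hz, z]
    · simpa [g] using Real.cos_arccos h2.1 h2.2
  refine (measure_mono hsub).trans_lt ((hC.hausdorffMeasure_image_le zero_le_two).trans_lt ?_)
  rw [hausdorffMeasure_prod_real]
  exact ENNReal.mul_lt_top (by finiteness) hK.measure_lt_top

instance : IsFiniteMeasure ((μH[2] : Measure E3).restrict (Metric.sphere 0 1)) :=
  ⟨by simpa using hausdorffMeasure_sphere_lt_top⟩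

theorem Continuous.integrable_sphere {f : E3 → ℝ} (hf : Continuous f) :
    Integrable f ((μH[2] : Measure E3).restrict (Metric.sphere 0 1)) := by
  obtain ⟨C, hC⟩ := (isCompact_sphere (0 : E3) 1).exists_bound_of_continuousOn hf.continuousOn
  refine Integrable.of_bound hf.aestronglyMeasurable C ?_
  filter_upwards [ae_restrict_mem Metric.isClosed_sphere.measurableSet] with x hx using hC x hx

/-- The infinitesimal generator of rotations in the plane of the coordinates `a` and `b`. -/
def rotField (a b : Fin 3) (x : E3) : E3 :=
  x a • EuclideanSpace.single b 1 - x b • EuclideanSpace.single a 1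

/-- Rotation by the angle `t` in the plane of the coordinates `a` and `b`. -/
def planeRot (a b : Fin 3) (t : ℝ) (x : E3) : E3 :=
  x + (Real.cos t - 1) • (x a • EuclideanSpace.single a 1 + x b • EuclideanSpace.single b 1) +
    Real.sin t • rotField a b x

theorem continuous_planeRot (a b : Fin 3) :
    Continuous fun p : ℝ × E3 => planeRot a b p.1 p.2 := by
  unfold planeRot rotField
  fun_prop

theorem norm_planeRot {a b : Fin 3} (hab : a ≠ b) (t : ℝ) (x : E3) :
    ‖planeRot a b t x‖ = ‖x‖ := by
  rw [← sq_eq_sq₀ (norm_nonneg _) (norm_nonneg _), EuclideanSpace.real_norm_sq_eq,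
    EuclideanSpace.real_norm_sq_eq]
  have h := Real.sin_sq_add_cos_sq t
  fin_cases a <;> fin_cases b <;>
    first
    | exact absurd rfl hab
    | simp [planeRot, rotField, Fin.sum_univ_three]
      linear_combination (x 0 ^ 2 + x 1 ^ 2) * h
    | simp [planeRot, rotField, Fin.sum_univ_three]
      linear_combination (x 0 ^ 2 + x 2 ^ 2) * h
    | simp [planeRot, rotField, Fin.sum_univ_three]
      linear_combination (x 1 ^ 2 + x 2 ^ 2) * h

/-- Rotation in a coordinate plane as a linear isometry. -/
def planeRotIsometry {a b : Fin 3} (hab : a ≠ b) (t : ℝ) : E3 →ₗᵢ[ℝ] E3 where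
  toFun := planeRot a b t
  map_add' x y := by simp only [planeRot, rotField, PiLp.add_apply]; module
  map_smul' c x := by
    simp only [planeRot, rotField, PiLp.smul_apply, smul_eq_mul, RingHom.id_apply]; module
  norm_map' := norm_planeRot hab t

theorem sphereInt_comp_planeRot {a b : Fin 3} (hab : a ≠ b) (t : ℝ) (f : E3 → ℝ) :
    sphereInt (fun x => f (planeRot a b t x)) = sphereInt f := by
  let R := (planeRotIsometry hab t).toLinearIsometryEquiv rfl
  have hR : MeasurePreserving R.toIsometryEquiv (μH[2] : Measure E3) μH[2] :=
    R.toIsometryEquiv.measurePreserving_hausdorffMeasure 2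
  have hpre : R.toIsometryEquiv ⁻¹' Metric.sphere (0 : E3) 1 = Metric.sphere 0 1 := by
    ext x
    simp
  have := hR.setIntegral_preimage_emb R.toHomeomorph.measurableEmbedding f (Metric.sphere 0 1)
  rw [hpre] at this
  exact this

theorem hasDerivAt_planeRot (a b : Fin 3) (t : ℝ) (x : E3) :
    HasDerivAt (fun s => planeRot a b s x)
      ((-Real.sin t) • (x a • EuclideanSpace.single a 1 + x b • EuclideanSpace.single b 1) +
        Real.cos t • rotField a b x) t := by
  unfold planeRot
  exact ((((Real.hasDerivAt_cos t).sub_const 1).smul_const _).const_add x).add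
    ((Real.hasDerivAt_sin t).smul_const _)

theorem sphereInt_fderiv_rotField {F : E3 → ℝ} (hF : ContDiff ℝ 1 F) (a b : Fin 3) :
    sphereInt (fun x => fderiv ℝ F x (rotField a b x)) = 0 := by
  rcases eq_or_ne a b with rfl | hab
  · simp [sphereInt, rotField]
  let F' : ℝ → E3 → ℝ := fun t x => fderiv ℝ F (planeRot a b t x)
    ((-Real.sin t) • (x a • EuclideanSpace.single a 1 + x b • EuclideanSpace.single b 1) +
      Real.cos t • rotField a b x)
  have hF' : Continuous fun p : ℝ × E3 => F' p.1 p.2 := by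
    refine ((hF.continuous_fderiv one_ne_zero).comp (continuous_planeRot a b)).clm_apply ?_
    unfold rotField
    fun_prop
  obtain ⟨C, hC⟩ := ((isCompact_Icc (a := (-1 : ℝ)) (b := 1)).prod
    (isCompact_sphere (0 : E3) 1)).exists_bound_of_continuousOn hF'.continuousOn
  have hc (t : ℝ) : Continuous fun x => F (planeRot a b t x) :=
    hF.continuous.comp ((continuous_planeRot a b).comp (Continuous.prodMk_right t))
  have hd := (hasDerivAt_integral_of_dominated_loc_of_deriv_le
    (μ := (μH[2] : Measure E3).restrict (Metric.sphere 0 1)) (bound := fun _ => C)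
    (F := fun t x => F (planeRot a b t x)) (F' := F') (x₀ := (0 : ℝ))
    (Icc_mem_nhds (by norm_num : (-1 : ℝ) < 0) one_pos)
    (.of_forall fun t => (hc t).aestronglyMeasurable) (hc 0).integrable_sphere
    (hF'.comp (Continuous.prodMk_right 0)).aestronglyMeasurable
    (by
      filter_upwards [ae_restrict_mem Metric.isClosed_sphere.measurableSet] with x hx t ht
      exact hC (t, x) ⟨ht, hx⟩)
    (integrable_const C)
    (.of_forall fun x t _ =>
      ((hF.differentiable one_ne_zero _).hasFDerivAt).comp_hasDerivAt t
        (hasDerivAt_planeRot a b t x))).2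
  have hconst : (fun t => ∫ x in Metric.sphere (0 : E3) 1, F (planeRot a b t x) ∂μH[2]) =
      fun _ => sphereInt F := funext fun t => sphereInt_comp_planeRot hab t F
  rw [hconst] at hd
  have h0 := hd.unique (hasDerivAt_const _ _)
  simpa [F', planeRot, sphereInt] using h0

theorem hasFDerivAt_homExt {f : E3 → ℝ} (hf : Differentiable ℝ f) {x : E3} (hx : ‖x‖ = 1) :
    HasFDerivAt (homExt f)
      (fderiv ℝ f x ∘L (ContinuousLinearMap.id ℝ E3 - (innerSL ℝ x).smulRight x)) x := by
  have hx0 : x ≠ 0 := by rintro rfl; simp at hx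
  have hn : HasFDerivAt (fun y : E3 => ‖y‖) (innerSL ℝ x) x := by
    have h := (hasStrictFDerivAt_norm_sq x).hasFDerivAt.sqrt (by simp [hx0])
    simp only [Real.sqrt_sq (norm_nonneg _), hx] at h
    refine h.congr_fderiv ?_
    ext v
    simp
  have hi : HasFDerivAt (fun y : E3 => ‖y‖⁻¹) (-(innerSL ℝ x)) x := by
    refine ((hasDerivAt_inv (norm_ne_zero_iff.2 hx0)).comp_hasFDerivAt x hn).congr_fderiv ?_
    simp [hx]
  have hs := hi.smul (hasFDerivAt_id x)
  have hfx : HasFDerivAt f (fderiv ℝ f x) (‖x‖⁻¹ • x) := by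
    simpa [hx] using (hf x).hasFDerivAt
  refine (HasFDerivAt.comp (f := fun y : E3 => ‖y‖⁻¹ • y) x hfx hs).congr_fderiv ?_
  ext v
  simp [hx, sub_eq_add_neg]

theorem inner_sGrad_coord {f : E3 → ℝ} (hf : Differentiable ℝ f) (i : Fin 3) {x : E3}
    (hx : ‖x‖ = 1) :
    ⟪sGrad (fun y => y i) x, sGrad f x⟫ =
      fderiv ℝ f x (EuclideanSpace.single i 1) - x i * fderiv ℝ f x x := by
  have hcoord : Differentiable ℝ fun y : E3 => y i := by fun_prop
  have hfd : fderiv ℝ (fun y : E3 => y i) x = EuclideanSpace.proj i :=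
    (EuclideanSpace.proj (𝕜 := ℝ) i).fderiv
  have hg : sGrad (fun y => y i) x = EuclideanSpace.single i 1 - x i • x := by
    refine ext_inner_right ℝ fun v => ?_
    rw [sGrad, gradient, InnerProductSpace.toDual_symm_apply, (hasFDerivAt_homExt hcoord hx).fderiv,
      hfd]
    simp [inner_sub_left, inner_smul_left, EuclideanSpace.inner_single_left, mul_comm]
  rw [real_inner_comm, hg, sGrad, gradient, InnerProductSpace.toDual_symm_apply,
    (hasFDerivAt_homExt hf hx).fderiv]
  simp [inner_sub_right, inner_smul_right, hx, EuclideanSpace.inner_single_right]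

theorem sum_mul_fderiv_rotField (f : E3 → ℝ) (i : Fin 3) {x : E3} (hx : ‖x‖ = 1) :
    ∑ k, x k * fderiv ℝ f x (rotField k i x) =
      fderiv ℝ f x (EuclideanSpace.single i 1) - x i * fderiv ℝ f x x := by
  have h1 : ∑ k, x k ^ 2 = 1 := by rw [← EuclideanSpace.real_norm_sq_eq, hx, one_pow]
  have h2 : ∑ k, x k • EuclideanSpace.single k (1 : ℝ) = x := by
    ext j
    simp [Pi.single_apply]
  calc _ = fderiv ℝ f x (∑ k, x k • rotField k i x) := by simp
    _ = fderiv ℝ f x ((∑ k, x k ^ 2) • EuclideanSpace.single i 1 -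
          x i • ∑ k, x k • EuclideanSpace.single k (1 : ℝ)) := by
      congr 1
      rw [Finset.sum_smul, Finset.smul_sum, ← Finset.sum_sub_distrib]
      refine Finset.sum_congr rfl fun k _ => ?_
      simp only [rotField]
      module
    _ = _ := by rw [h1, h2]; simp

theorem hasFDerivAt_quadratic (D : Matrix (Fin 3) (Fin 3) ℝ) (x : E3) :
    HasFDerivAt (fun y : E3 => ∑ m, ∑ n, D m n * y m * y n)
      (∑ m, ∑ n, ((D m n * x m) • EuclideanSpace.proj (𝕜 := ℝ) n +
        x n • D m n • EuclideanSpace.proj (𝕜 := ℝ) m) : E3 →L[ℝ] ℝ) x := by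
  refine HasFDerivAt.fun_sum fun m _ => HasFDerivAt.fun_sum fun n _ => ?_
  exact ((EuclideanSpace.proj (𝕜 := ℝ) m).hasFDerivAt.const_mul (D m n)).mul
    (EuclideanSpace.proj (𝕜 := ℝ) n).hasFDerivAt

/-- Summing the rotational derivatives of `W x^k P` over `k`, where `W` is a quadratic form. -/
theorem sum_fderiv_rotField_quadratic {D : Matrix (Fin 3) (Fin 3) ℝ} (hsym : D.IsSymm)
    {P : E3 → ℝ} (hP : Differentiable ℝ P) (i : Fin 3) {x : E3} (hx : ‖x‖ = 1) :
    ∑ k, fderiv ℝ (fun y : E3 => (∑ m, ∑ n, D m n * y m * y n) * y k * P y) x (rotField k i x) =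
      (∑ m, ∑ n, D m n * x m * x n) * ⟪sGrad (fun y => y i) x, sGrad P x⟫ +
        2 * ∑ j, D i j * (P x * x j) - 4 * ((∑ m, ∑ n, D m n * x m * x n) * x i * P x) := by
  have hW := hasFDerivAt_quadratic D x
  set W : E3 → ℝ := fun y => ∑ m, ∑ n, D m n * y m * y n with hWdef
  have hsumW := sum_mul_fderiv_rotField W i hx
  have hk (k : Fin 3) : fderiv ℝ (fun y : E3 => W y * y k * P y) x (rotField k i x) =
      W x * (x k * fderiv ℝ P x (rotField k i x)) +
        P x * (x k * fderiv ℝ W x (rotField k i x)) + P x * W x * rotField k i x k := by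
    have hcoord : HasFDerivAt (fun y : E3 => y k) (EuclideanSpace.proj (𝕜 := ℝ) k) x :=
      (EuclideanSpace.proj (𝕜 := ℝ) k).hasFDerivAt
    rw [((hW.fun_mul hcoord).fun_mul (hP x).hasFDerivAt).fderiv, hW.fderiv]
    simp only [add_apply, smul_apply, smul_eq_mul, PiLp.proj_apply]
    ring
  have hrot : ∑ k, rotField k i x k = -2 * x i := by
    fin_cases i <;> simp [rotField] <;> ring
  have hgrad : fderiv ℝ W x (EuclideanSpace.single i 1) - x i * fderiv ℝ W x x =
      2 * ∑ j, D i j * x j - 2 * x i * W x := by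
    have h01 := hsym.apply 0 1
    have h02 := hsym.apply 0 2
    have h12 := hsym.apply 1 2
    rw [hW.fderiv]
    fin_cases i <;> simp [hWdef, Fin.sum_univ_three, h01, h02, h12] <;> ring
  rw [Finset.sum_congr rfl fun k _ => hk k,
    Finset.sum_add_distrib, Finset.sum_add_distrib, ← Finset.mul_sum, ← Finset.mul_sum,
    ← Finset.mul_sum, hrot, hsumW, hgrad, sum_mul_fderiv_rotField P i hx, inner_sGrad_coord hP i hx]
  have : ∑ j, D i j * (P x * x j) = P x * ∑ j, D i j * x j := by
    rw [Finset.mul_sum]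
    exact Finset.sum_congr rfl fun j _ => by ring
  rw [this]
  ring

theorem stmt8 (D : Matrix (Fin 3) (Fin 3) ℝ) (hsym : D.IsSymm) (htr : D.trace = 0)
    (W₀ : E3 → ℝ) (hW₀ : W₀ = fun x => ∑ m : Fin 3, ∑ n : Fin 3, D m n * x m * x n)
    (P : E3 → ℝ) (hP : ContDiff ℝ (⊤ : ℕ∞) P)
    (horth : ∀ m : Fin 3, sphereInt (fun x => P x * x m) = 0) (i : Fin 3) :
    sphereInt (fun x => W₀ x * ⟪sGrad (fun y => y i) x, sGrad P x⟫) =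
      4 * sphereInt (fun x => W₀ x * x i * P x) := by
  subst hW₀
  have hP1 : ContDiff ℝ 1 P := hP.of_le (mod_cast le_top)
  have hPd : Differentiable ℝ P := hP1.differentiable one_ne_zero
  have hPc : Continuous P := hP1.continuous
  set W : E3 → ℝ := fun x => ∑ m : Fin 3, ∑ n : Fin 3, D m n * x m * x n with hW
  have hWs : ContDiff ℝ 1 W := by fun_prop
  have hF (k : Fin 3) : ContDiff ℝ 1 fun y : E3 => W y * y k * P y := by fun_prop
  let G : Fin 3 → E3 → ℝ := fun k x =>
    fderiv ℝ (fun y : E3 => W y * y k * P y) x (rotField k i x)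
  have hG (k : Fin 3) : Continuous (G k) := by
    refine ((hF k).continuous_fderiv one_ne_zero).clm_apply ?_
    unfold rotField
    fun_prop
  have hG0 (k : Fin 3) : sphereInt (G k) = 0 := sphereInt_fderiv_rotField (hF k) k i
  have hWc : Continuous W := hWs.continuous
  have hcoord (j : Fin 3) : Continuous fun x : E3 => D i j * (P x * x j) := by fun_prop
  have hmain : Continuous fun x : E3 => 4 * (W x * x i * P x) := by fun_prop
  have hcongr : sphereInt (fun x => W x * ⟪sGrad (fun y => y i) x, sGrad P x⟫) =
      sphereInt (fun x => ∑ k, G k x - 2 * ∑ j, D i j * (P x * x j) + 4 * (W x * x i * P x)) := by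
    refine setIntegral_congr_fun Metric.isClosed_sphere.measurableSet fun x hx => ?_
    have h := sum_fderiv_rotField_quadratic hsym hPd i (mem_sphere_zero_iff_norm.1 hx)
    simp only [G, hW]
    rw [h]
    ring
  rw [hcongr]
  unfold sphereInt at *
  rw [integral_add (Continuous.integrable_sphere (by fun_prop)) hmain.integrable_sphere,
    integral_sub (Continuous.integrable_sphere (by fun_prop))
      (Continuous.integrable_sphere (by fun_prop)),
    integral_finsetSum _ fun k _ => (hG k).integrable_sphere, integral_const_mul,
    integral_finsetSum _ fun j _ => (hcoord j).integrable_sphere, integral_const_mul]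
  simp [integral_const_mul, hG0, horth]

end
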